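/- (Yoccoz) The inclusions CD ⊂ H ⊂ B hold and both inclusions are strict, where CD is the set of Diophantine numbers, B is the set of Brjuno numbers, and H is the set of Brjuno numbers satisfying condition H. -/

import Mathlib

open Filter Topology

/-- `α` is Diophantine with exponent `σ` and constant `γ`:
`|α - p/q| ≥ γ / q^(2+σ)` for all rationals `p/q`. -/
def IsDiophantineWith (γ σ α : ℝ) : Prop :=
  ∀ (p : ℤ) (q : ℕ), 0 < q → γ / (q : ℝ) ^ ((2 : ℝ) + σ) ≤ |α - (p : ℝ) / (q : ℝ)|

/-- `α` is a Diophantine number. -/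
def IsDiophantine (α : ℝ) : Prop :=
  ∃ γ > (0 : ℝ), ∃ σ ≥ (0 : ℝ), IsDiophantineWith γ σ α

/-- Iterates of the Gauss map `G(x) = {1/x}`, starting from the fractional part of `α`:
`α₀ = {α}`, `α_{n+1} = {1/α_n}`. -/
noncomputable def gaussIter (α : ℝ) : ℕ → ℝ
  | 0 => Int.fract α
  | n + 1 => Int.fract (gaussIter α n)⁻¹

/-- The `(n+1)`-st partial quotient `a_{n+1} = ⌊1/α_n⌋` of the continued fraction of `α`. -/
noncomputable def cfa (α : ℝ) (n : ℕ) : ℕ := ⌊(gaussIter α n)⁻¹⌋₊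

/-- The denominators `q_n` of the convergents of `α`: `q₀ = 1`, `q₁ = a₁`,
`q_{n+2} = a_{n+2} q_{n+1} + q_n`. -/
noncomputable def qden (α : ℝ) : ℕ → ℕ
  | 0 => 1
  | 1 => cfa α 0
  | n + 2 => cfa α (n + 1) * qden α (n + 1) + qden α n

/-- The Brjuno condition: `Σ_n log(q_{n+1})/q_n < ∞`. -/
def IsBrjuno (α : ℝ) : Prop :=
  Summable fun n : ℕ => Real.log (qden α (n + 1)) / (qden α n : ℝ)

/-- The Brjuno function `B(α) = Σ_{n≥0} (α₀ ⋯ α_{n-1}) log(1/α_n)` (with values in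
`[0,∞]`), the `1`-periodic solution of `B(x) = x B({1/x}) + log(1/x)` on `(0,1)`;
`α` is a Brjuno number iff `B(α) < ∞`. -/
noncomputable def brjunoFunction (α : ℝ) : ENNReal :=
  ∑' n : ℕ, ENNReal.ofReal
    ((∏ k ∈ Finset.range n, gaussIter α k) * Real.log (gaussIter α n)⁻¹)

/-- Yoccoz's function `𝓡_α`: `𝓡_α(r) = α⁻¹ (r - log α⁻¹ + 1)` for `r ≥ log α⁻¹`,
and `𝓡_α(r) = e^r` for `r ≤ log α⁻¹`. -/
noncomputable def Rcal (α r : ℝ) : ℝ :=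
  if Real.log α⁻¹ ≤ r then α⁻¹ * (r - Real.log α⁻¹ + 1) else Real.exp r

/-- The sequence `R_n(α)`: `R_0(α) = 0`, `R_{n+1}(α) = 𝓡_{α_n}(R_n(α))` where
`α_n = Gⁿ(α)` are the Gauss iterates. -/
noncomputable def Rseq (α : ℝ) : ℕ → ℝ
  | 0 => 0
  | n + 1 => Rcal (gaussIter α n) (Rseq α n)

/-- Yoccoz's condition `𝓗`: `α` is a Brjuno number and for every `m` there is a `k ≥ 0`
with `R_k(α_m) ≥ B(α_{m+k})`. -/
def SatisfiesCondH (α : ℝ) : Prop :=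
  IsBrjuno α ∧ ∀ m : ℕ, ∃ k : ℕ,
    brjunoFunction (gaussIter α (m + k)) ≤ ENNReal.ofReal (Rseq (gaussIter α m) k)

/-- The set `CD` of Diophantine numbers in `(0,1)`. -/
def CDSet : Set ℝ := {α | α ∈ Set.Ioo (0 : ℝ) 1 ∧ Irrational α ∧ IsDiophantine α}

/-- The set `𝓗` of numbers in `(0,1)` satisfying Yoccoz's condition `𝓗`. -/
def HSet : Set ℝ := {α | α ∈ Set.Ioo (0 : ℝ) 1 ∧ Irrational α ∧ SatisfiesCondH α}

/-- The set `𝓑` of Brjuno numbers in `(0,1)`. -/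
def BSet : Set ℝ := {α | α ∈ Set.Ioo (0 : ℝ) 1 ∧ Irrational α ∧ IsBrjuno α}

/-- The logarithmic size `log (1/α_n)` of the Gauss iterates. -/
noncomputable def logIter (α : ℝ) (n : ℕ) : ℝ := Real.log (gaussIter α n)⁻¹

/-- The sum `log (1/α_0) + ⋯ + log (1/α_{n-1})`, so that `α_0 ⋯ α_{n-1} = exp (-logSum α n)`. -/
noncomputable def logSum (α : ℝ) (n : ℕ) : ℝ := ∑ j ∈ Finset.range n, logIter α j

/-- No Gauss iterate of `α` vanishes. -/
def HasInfiniteExpansion (α : ℝ) : Prop := ∀ n, gaussIter α n ∈ Set.Ioo (0 : ℝ) 1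

/-- The sums of logarithms grow at most quadratically from one step to the next. -/
def HasQuadraticGrowth (α : ℝ) : Prop :=
  ∃ A : ℝ, 1 ≤ A ∧ ∀ n, logSum α (n + 1) ≤ A * (1 + logSum α n) ^ 2

lemma logSum_zero (α : ℝ) : logSum α 0 = 0 := by simp [logSum]

lemma logSum_succ (α : ℝ) (n : ℕ) : logSum α (n + 1) = logSum α n + logIter α n := by
  simp [logSum, Finset.sum_range_succ]

lemma irrational_gaussIter {α : ℝ} (h : Irrational α) (n : ℕ) : Irrational (gaussIter α n) := by
  induction n with
  | zero => exact h.sub_intCast _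
  | succ n ih => exact ih.inv.sub_intCast _

lemma Irrational.hasInfiniteExpansion {α : ℝ} (h : Irrational α) : HasInfiniteExpansion α := by
  intro n
  have h0 : 0 ≤ gaussIter α n := by cases n <;> exact Int.fract_nonneg _
  have h1 : gaussIter α n < 1 := by cases n <;> exact Int.fract_lt_one _
  exact ⟨lt_of_le_of_ne h0 (irrational_gaussIter h n).ne_zero.symm, h1⟩

lemma fract_gaussIter (α : ℝ) (n : ℕ) : Int.fract (gaussIter α n) = gaussIter α n := by
  cases n <;> simp [gaussIter]

lemma gaussIter_gaussIter (α : ℝ) (m k : ℕ) :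
    gaussIter (gaussIter α m) k = gaussIter α (m + k) := by
  induction k with
  | zero => exact fract_gaussIter α m
  | succ k ih => rw [← Nat.add_assoc]; simp only [gaussIter, ih]

lemma HasInfiniteExpansion.gaussIter {α : ℝ} (h : HasInfiniteExpansion α) (m : ℕ) :
    HasInfiniteExpansion (gaussIter α m) := fun n => by
  rw [gaussIter_gaussIter]; exact h _

lemma logIter_gaussIter (α : ℝ) (m k : ℕ) : logIter (gaussIter α m) k = logIter α (m + k) := by
  simp only [logIter, gaussIter_gaussIter]

lemma logSum_gaussIter (α : ℝ) (m k : ℕ) :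
    logSum (gaussIter α m) k = logSum α (m + k) - logSum α m := by
  simp only [logSum, logIter_gaussIter, Finset.sum_range_add]; ring

lemma logIter_pos {α : ℝ} (h : HasInfiniteExpansion α) (n : ℕ) : 0 < logIter α n :=
  Real.log_pos ((one_lt_inv₀ (h n).1).2 (h n).2)

lemma exp_logIter {α : ℝ} (h : HasInfiniteExpansion α) (n : ℕ) :
    Real.exp (logIter α n) = (gaussIter α n)⁻¹ :=
  Real.exp_log (inv_pos.2 (h n).1)

lemma logSum_mono {α : ℝ} (h : HasInfiniteExpansion α) : Monotone (logSum α) :=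
  monotone_nat_of_le_succ fun n => by
    rw [logSum_succ]; linarith [logIter_pos h n]

lemma logSum_nonneg {α : ℝ} (h : HasInfiniteExpansion α) (n : ℕ) : 0 ≤ logSum α n :=
  logSum_zero α ▸ logSum_mono h n.zero_le

lemma prod_gaussIter {α : ℝ} (h : HasInfiniteExpansion α) (n : ℕ) :
    ∏ k ∈ Finset.range n, gaussIter α k = Real.exp (-logSum α n) := by
  rw [logSum, ← Finset.sum_neg_distrib, Real.exp_sum]
  refine Finset.prod_congr rfl fun k _ => ?_
  rw [Real.exp_neg, exp_logIter h, inv_inv]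

lemma inv_gaussIter {α : ℝ} (h : HasInfiniteExpansion α) (n : ℕ) :
    (gaussIter α n)⁻¹ = cfa α n + gaussIter α (n + 1) := by
  have := Int.floor_add_fract (gaussIter α n)⁻¹
  rw [cfa, natCast_floor_eq_intCast_floor (inv_nonneg.2 (h n).1.le), gaussIter, this]

lemma one_le_cfa {α : ℝ} (h : HasInfiniteExpansion α) (n : ℕ) : 1 ≤ cfa α n :=
  Nat.le_floor (by simpa using ((one_lt_inv₀ (h n).1).2 (h n).2).le)

lemma exp_logSum_recurrence {α : ℝ} (h : HasInfiniteExpansion α) (n : ℕ) :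
    Real.exp (-logSum α n) =
      cfa α n * Real.exp (-logSum α (n + 1)) + Real.exp (-logSum α (n + 2)) := by
  have h1 := inv_gaussIter h n
  have h0 := (h n).1.ne'
  simp only [← prod_gaussIter h, Finset.prod_range_succ]
  have : gaussIter α n * (cfa α n + gaussIter α (n + 1)) = 1 := by
    rw [← h1]; exact mul_inv_cancel₀ h0
  linear_combination (-∏ k ∈ Finset.range n, gaussIter α k) * this

lemma log_two_le_logIter_add {α : ℝ} (h : HasInfiniteExpansion α) (n : ℕ) :
    Real.log 2 ≤ logIter α n + logIter α (n + 1) := by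
  have h1 := inv_gaussIter h n
  have ha : (1 : ℝ) ≤ cfa α n := by exact_mod_cast one_le_cfa h n
  have h2 := h n
  have h3 := h (n + 1)
  rw [logIter, logIter, ← Real.log_mul (inv_pos.2 h2.1).ne' (inv_pos.2 h3.1).ne']
  refine Real.log_le_log two_pos ?_
  rw [h1, ← div_eq_mul_inv, le_div_iff₀ h3.1]
  linarith [h3.2]

lemma log_two_mul_le_logSum {α : ℝ} (h : HasInfiniteExpansion α) (n : ℕ) :
    Real.log 2 * ((n : ℝ) - 1) / 2 ≤ logSum α n := by
  have hl : 0 < Real.log 2 := Real.log_pos one_lt_two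
  induction n using Nat.twoStepInduction with
  | zero => rw [logSum_zero]; push_cast; linarith
  | one => simpa using logSum_nonneg h 1
  | more n ih _ =>
    have := log_two_le_logIter_add h n
    rw [logSum_succ, logSum_succ]
    push_cast
    linarith

lemma tendsto_logSum {α : ℝ} (h : HasInfiniteExpansion α) : Tendsto (logSum α) atTop atTop := by
  refine tendsto_atTop_mono (log_two_mul_le_logSum h) ?_
  have hl : 0 < Real.log 2 := Real.log_pos one_lt_two
  exact ((tendsto_natCast_atTop_atTop.atTop_add tendsto_const_nhds).const_mul_atTop hl).atTop_div_const
    two_pos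

lemma exp_neg_half_logSum_le {α : ℝ} (h : HasInfiniteExpansion α) (n : ℕ) :
    Real.exp (-(logSum α n / 2)) ≤ Real.exp (n * (-(Real.log 2 / 4))) * Real.exp (Real.log 2 / 4) := by
  rw [← Real.exp_add]
  refine Real.exp_le_exp.2 ?_
  linarith [log_two_mul_le_logSum h n]

lemma summable_geometric_majorant :
    Summable fun n : ℕ => Real.exp (n * (-(Real.log 2 / 4))) * Real.exp (Real.log 2 / 4) := by
  have hl : 0 < Real.log 2 := Real.log_pos one_lt_two
  exact (Real.summable_exp_nat_mul_iff.2 (by linarith)).mul_right _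

lemma summable_exp_neg_half_logSum {α : ℝ} (h : HasInfiniteExpansion α) :
    Summable fun n => Real.exp (-(logSum α n / 2)) :=
  summable_geometric_majorant.of_nonneg_of_le (fun _ => (Real.exp_pos _).le)
    (exp_neg_half_logSum_le h)

lemma one_add_sq_mul_exp_neg_le {t : ℝ} (ht : 0 ≤ t) :
    (1 + t) ^ 2 * Real.exp (-t) ≤ 16 * Real.exp (-(t / 2)) := by
  have h1 : 1 + t ≤ 4 * Real.exp (t / 4) := by linarith [Real.add_one_le_exp (t / 4)]
  have h2 : (1 + t) ^ 2 ≤ 16 * Real.exp (t / 2) := by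
    calc (1 + t) ^ 2 ≤ (4 * Real.exp (t / 4)) ^ 2 := by gcongr
      _ = 16 * Real.exp (t / 2) := by
        rw [mul_pow, ← Real.exp_nat_mul]; norm_num; ring_nf
  calc (1 + t) ^ 2 * Real.exp (-t) ≤ 16 * Real.exp (t / 2) * Real.exp (-t) := by gcongr
    _ = 16 * Real.exp (-(t / 2)) := by rw [mul_assoc, ← Real.exp_add]; ring_nf

/-! ### Convergents -/

lemma one_le_qden {α : ℝ} (h : HasInfiniteExpansion α) (n : ℕ) : 1 ≤ qden α n := by
  induction n using Nat.twoStepInduction with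
  | zero => simp [qden]
  | one => exact one_le_cfa h 0
  | more n ih _ => simp only [qden]; omega

lemma qden_le_succ {α : ℝ} (h : HasInfiniteExpansion α) (n : ℕ) : qden α n ≤ qden α (n + 1) := by
  cases n with
  | zero => exact one_le_cfa h 0
  | succ n =>
    have := Nat.mul_le_mul_right (qden α (n + 1)) (one_le_cfa h (n + 1))
    simp only [qden] at this ⊢
    omega

lemma qden_exp_identity {α : ℝ} (h : HasInfiniteExpansion α) (n : ℕ) :
    qden α (n + 1) * Real.exp (-logSum α (n + 1)) + qden α n * Real.exp (-logSum α (n + 2)) = 1 := by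
  induction n with
  | zero =>
    have := exp_logSum_recurrence h 0
    rw [logSum_zero, neg_zero, Real.exp_zero] at this
    simp only [qden, Nat.cast_one, one_mul]
    exact this.symm
  | succ n ih =>
    have := exp_logSum_recurrence h (n + 1)
    simp only [qden, Nat.cast_add, Nat.cast_mul] at ih ⊢
    rw [← ih]
    linear_combination (-(qden α (n + 1) : ℝ)) * this

lemma qden_mul_exp_le {α : ℝ} (h : HasInfiniteExpansion α) (n : ℕ) :
    qden α n * Real.exp (-logSum α n) ≤ 1 := by
  cases n with
  | zero => simp [qden, logSum_zero]
  | succ n =>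
    have h1 := qden_exp_identity h n
    have h2 : 0 ≤ qden α n * Real.exp (-logSum α (n + 2)) := by positivity
    linarith

lemma one_le_two_mul_qden_mul_exp {α : ℝ} (h : HasInfiniteExpansion α) (n : ℕ) :
    1 ≤ 2 * (qden α n * Real.exp (-logSum α n)) := by
  cases n with
  | zero => simp [qden, logSum_zero]
  | succ n =>
    have h1 := qden_exp_identity h n
    have h2 : (qden α n : ℝ) ≤ qden α (n + 1) := by exact_mod_cast qden_le_succ h n
    have h3 : Real.exp (-logSum α (n + 2)) ≤ Real.exp (-logSum α (n + 1)) :=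
      Real.exp_le_exp.2 (neg_le_neg (logSum_mono h (Nat.le_succ _)))
    have h4 : qden α n * Real.exp (-logSum α (n + 2)) ≤
      qden α (n + 1) * Real.exp (-logSum α (n + 1)) := by gcongr
    linarith

lemma log_qden_le {α : ℝ} (h : HasInfiniteExpansion α) (n : ℕ) :
    Real.log (qden α n) ≤ logSum α n := by
  have hq : (0 : ℝ) < qden α n := by exact_mod_cast one_le_qden h n
  rw [Real.log_le_iff_le_exp hq]
  have := qden_mul_exp_le h n
  rwa [Real.exp_neg, ← div_eq_mul_inv, div_le_one (Real.exp_pos _)] at this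

lemma exists_qden_mul_sub {α : ℝ} (h : HasInfiniteExpansion α) (n : ℕ) :
    ∃ p : ℤ, qden α n * α - p = (-1) ^ n * Real.exp (-logSum α (n + 1)) := by
  have h0 : Real.exp (-logSum α 1) = Int.fract α := by
    rw [← prod_gaussIter h]; simp [gaussIter]
  induction n using Nat.twoStepInduction with
  | zero => exact ⟨⌊α⌋, by simp [qden, h0]⟩
  | one =>
    have h1 := exp_logSum_recurrence h 0
    rw [logSum_zero, neg_zero, Real.exp_zero, zero_add, h0] at h1
    refine ⟨1 + cfa α 0 * ⌊α⌋, ?_⟩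
    rw [Int.fract] at h1
    simp only [qden]
    push_cast
    linear_combination -h1
  | more n ih ih' =>
    obtain ⟨p, hp⟩ := ih
    obtain ⟨p', hp'⟩ := ih'
    refine ⟨cfa α (n + 1) * p' + p, ?_⟩
    have := exp_logSum_recurrence h (n + 1)
    simp only [qden]
    push_cast
    rw [pow_succ] at hp'
    rw [pow_add]
    linear_combination (cfa α (n + 1) : ℝ) * hp' + hp + (-1) ^ n * this

lemma HasInfiniteExpansion.irrational {α : ℝ} (h : HasInfiniteExpansion α) : Irrational α := by
  rintro ⟨r, rfl⟩
  have hlim : Tendsto (fun n => Real.exp (-logSum (r : ℝ) (n + 1))) atTop (𝓝 0) :=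
    (Real.tendsto_exp_neg_atTop_nhds_zero.comp (tendsto_logSum h)).comp (tendsto_add_atTop_nat 1)
  have hd : (0 : ℝ) < r.den := by exact_mod_cast r.den_pos
  obtain ⟨n, hn⟩ := (hlim.eventually_lt_const (inv_pos.2 hd)).exists
  obtain ⟨p, hp⟩ := exists_qden_mul_sub h n
  have hr : (r : ℝ) * r.den = r.num := by exact_mod_cast r.mul_den_eq_num
  have hz : ((qden (r : ℝ) n * r.num - p * r.den : ℤ) : ℝ) =
      (-1) ^ n * Real.exp (-logSum (r : ℝ) (n + 1)) * r.den := by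
    push_cast
    rw [← hp, ← hr]; ring
  have habs : |((qden (r : ℝ) n * r.num - p * r.den : ℤ) : ℝ)| =
      Real.exp (-logSum (r : ℝ) (n + 1)) * r.den := by
    rw [hz, abs_mul, abs_mul, abs_pow, abs_neg, abs_one, one_pow, one_mul, Real.abs_exp,
      abs_of_pos hd]
  have hpos : 0 < Real.exp (-logSum (r : ℝ) (n + 1)) * r.den := by positivity
  have hlt : Real.exp (-logSum (r : ℝ) (n + 1)) * r.den < 1 := by
    rwa [← lt_div_iff₀ hd, one_div]
  rw [← habs, ← Int.cast_abs] at hpos hlt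
  have h1 : (0 : ℤ) < |(qden (r : ℝ) n * r.num - p * r.den : ℤ)| := by exact_mod_cast hpos
  have h2 : |(qden (r : ℝ) n * r.num - p * r.den : ℤ)| < (1 : ℤ) := by exact_mod_cast hlt
  omega

/-! ### The Brjuno condition -/

lemma isBrjuno_of_summable {α : ℝ} (h : HasInfiniteExpansion α)
    (hs : Summable fun n => Real.exp (-logSum α n) * logIter α n) : IsBrjuno α := by
  have hs' : Summable fun n => 2 * (16 * Real.exp (-(logSum α n / 2)) +
      Real.exp (-logSum α n) * logIter α n) :=
    (((summable_exp_neg_half_logSum h).mul_left 16).add hs).mul_left 2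
  refine hs'.of_nonneg_of_le (fun n => div_nonneg (Real.log_natCast_nonneg _) (Nat.cast_nonneg _))
    fun n => ?_
  have hq : (0 : ℝ) < qden α n := by exact_mod_cast one_le_qden h n
  have hL := logSum_nonneg h n
  have h1 : Real.log (qden α (n + 1)) ≤ logSum α n + logIter α n :=
    (log_qden_le h (n + 1)).trans_eq (logSum_succ α n)
  have h2 : logSum α n * Real.exp (-logSum α n) ≤ 16 * Real.exp (-(logSum α n / 2)) :=
    le_trans (by gcongr; nlinarith) (one_add_sq_mul_exp_neg_le hL)
  rw [div_le_iff₀ hq]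
  have h3 := one_le_two_mul_qden_mul_exp h n
  have h4 : 0 ≤ logSum α n + logIter α n := by linarith [logIter_pos h n]
  calc Real.log (qden α (n + 1)) ≤ (logSum α n + logIter α n) * 1 := by linarith
    _ ≤ (logSum α n + logIter α n) * (2 * (qden α n * Real.exp (-logSum α n))) := by gcongr
    _ = 2 * (logSum α n * Real.exp (-logSum α n) + Real.exp (-logSum α n) * logIter α n) *
        qden α n := by ring
    _ ≤ _ := by gcongr

lemma HasQuadraticGrowth.gaussIter {α : ℝ} (h : HasInfiniteExpansion α)
    (hq : HasQuadraticGrowth α) (m : ℕ) : HasQuadraticGrowth (gaussIter α m) := by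
  obtain ⟨A, hA, hq⟩ := hq
  have hm := logSum_nonneg h m
  refine ⟨A * (1 + logSum α m) ^ 2, one_le_mul_of_one_le_of_one_le hA (by nlinarith), fun k => ?_⟩
  have hk : 0 ≤ logSum (_root_.gaussIter α m) k := logSum_nonneg (h.gaussIter m) k
  have h1 := hq (m + k)
  have h2 := logSum_gaussIter α m k
  have h3 := logSum_gaussIter α m (k + 1)
  set u := logSum (_root_.gaussIter α m) k
  have h4 : logSum α (m + k) = logSum α m + u := by linarith
  rw [← Nat.add_assoc] at h3
  rw [h4] at h1
  calc logSum (_root_.gaussIter α m) (k + 1) ≤ A * (1 + (logSum α m + u)) ^ 2 := by linarith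
    _ ≤ A * ((1 + logSum α m) * (1 + u)) ^ 2 := by
      gcongr
      nlinarith
    _ = _ := by ring

lemma HasQuadraticGrowth.isBrjuno {α : ℝ} (h : HasInfiniteExpansion α)
    (hq : HasQuadraticGrowth α) : IsBrjuno α := by
  obtain ⟨A, hA, hq⟩ := hq
  refine isBrjuno_of_summable h (((summable_exp_neg_half_logSum h).mul_left (A * 16)).of_nonneg_of_le
    (fun n => mul_nonneg (Real.exp_pos _).le (logIter_pos h n).le) fun n => ?_)
  have hL := logSum_nonneg h n
  have h1 : logIter α n ≤ A * (1 + logSum α n) ^ 2 := by linarith [hq n, logSum_succ α n]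
  calc Real.exp (-logSum α n) * logIter α n
      ≤ Real.exp (-logSum α n) * (A * (1 + logSum α n) ^ 2) := by gcongr
    _ = A * ((1 + logSum α n) ^ 2 * Real.exp (-logSum α n)) := by ring
    _ ≤ A * (16 * Real.exp (-(logSum α n / 2))) :=
      mul_le_mul_of_nonneg_left (one_add_sq_mul_exp_neg_le hL) (by linarith)
    _ = _ := by ring

lemma HasQuadraticGrowth.exists_brjunoFunction_le {α : ℝ} (h : HasInfiniteExpansion α)
    (hq : HasQuadraticGrowth α) : ∃ C : ℝ, ∀ n,
      brjunoFunction (_root_.gaussIter α n) ≤ ENNReal.ofReal (C * (1 + logSum α n) ^ 2) := by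
  obtain ⟨A, hA, hq⟩ := hq
  set f : ℕ → ℝ := fun j => Real.exp (j * (-(Real.log 2 / 4))) * Real.exp (Real.log 2 / 4)
  refine ⟨A * 16 * ∑' j, f j, fun n => ?_⟩
  have hn := logSum_nonneg h n
  have hf : ∀ j, 0 ≤ A * 16 * (1 + logSum α n) ^ 2 * f j := fun j => by positivity
  have hsum : A * 16 * (∑' j, f j) * (1 + logSum α n) ^ 2 =
      ∑' j, A * 16 * (1 + logSum α n) ^ 2 * f j := by
    rw [tsum_mul_left]; ring
  rw [hsum, ENNReal.ofReal_tsum_of_nonneg hf (summable_geometric_majorant.mul_left _)]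
  refine ENNReal.tsum_le_tsum fun j => ENNReal.ofReal_le_ofReal ?_
  have hβ := h.gaussIter n
  have hj := logSum_nonneg hβ j
  have h1 : logIter (_root_.gaussIter α n) j ≤
      A * ((1 + logSum α n) * (1 + logSum (_root_.gaussIter α n) j)) ^ 2 := by
    have h2 : logSum α (n + j) = logSum α n + logSum (_root_.gaussIter α n) j := by
      linarith [logSum_gaussIter α n j]
    calc logIter (_root_.gaussIter α n) j = logSum α (n + j + 1) - logSum α (n + j) := by
          rw [logIter_gaussIter, logSum_succ]; ring
      _ ≤ A * (1 + logSum α (n + j)) ^ 2 := by linarith [hq (n + j), logSum_nonneg h (n + j)]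
      _ ≤ _ := by rw [h2]; gcongr; nlinarith
  rw [prod_gaussIter hβ]
  calc Real.exp (-logSum (_root_.gaussIter α n) j) * logIter (_root_.gaussIter α n) j
      ≤ Real.exp (-logSum (_root_.gaussIter α n) j) *
        (A * ((1 + logSum α n) * (1 + logSum (_root_.gaussIter α n) j)) ^ 2) := by gcongr
    _ = A * (1 + logSum α n) ^ 2 * ((1 + logSum (_root_.gaussIter α n) j) ^ 2 *
        Real.exp (-logSum (_root_.gaussIter α n) j)) := by ring
    _ ≤ A * (1 + logSum α n) ^ 2 * (16 * f j) :=
      mul_le_mul_of_nonneg_left ((one_add_sq_mul_exp_neg_le hj).trans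
        (mul_le_mul_of_nonneg_left (exp_neg_half_logSum_le hβ j) (by norm_num))) (by positivity)
    _ = _ := by ring

/-! ### Growth of `R_n` -/

lemma eventually_const_mul_pow_le_exp (C : ℝ) (k : ℕ) :
    ∀ᶠ r : ℝ in atTop, C * r ^ k ≤ Real.exp r := by
  have h := (Real.isLittleO_pow_exp_atTop (n := k)).bound (c := (|C| + 1)⁻¹) (by positivity)
  filter_upwards [h, eventually_ge_atTop 0] with r hr h0
  rw [Real.norm_of_nonneg (by positivity), Real.norm_of_nonneg (Real.exp_pos _).le,
    inv_mul_eq_div, le_div_iff₀ (by positivity)] at hr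
  have : C * r ^ k ≤ (|C| + 1) * r ^ k := by
    gcongr; linarith [le_abs_self C]
  linarith

lemma Rseq_succ_of_le {α : ℝ} (h : HasInfiniteExpansion α) {n : ℕ} (hn : logIter α n ≤ Rseq α n) :
    Rseq α (n + 1) = Real.exp (logIter α n) * (Rseq α n - logIter α n + 1) := by
  rw [Rseq, Rcal, exp_logIter h]
  exact if_pos hn

lemma Rseq_succ_of_lt {α : ℝ} {n : ℕ} (hn : Rseq α n < logIter α n) :
    Rseq α (n + 1) = Real.exp (Rseq α n) := by
  rw [Rseq, Rcal]
  exact if_neg (not_le.2 hn)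

lemma Rseq_add_one_le {α : ℝ} (h : HasInfiniteExpansion α) (n : ℕ) :
    Rseq α n + 1 ≤ Rseq α (n + 1) := by
  rcases le_or_gt (logIter α n) (Rseq α n) with hn | hn
  · rw [Rseq_succ_of_le h hn]
    have h1 := Real.add_one_le_exp (logIter α n)
    have h2 := logIter_pos h n
    nlinarith
  · rw [Rseq_succ_of_lt hn]
    exact Real.add_one_le_exp _

lemma natCast_le_Rseq {α : ℝ} (h : HasInfiniteExpansion α) (n : ℕ) : (n : ℝ) ≤ Rseq α n := by
  induction n with
  | zero => simp [Rseq]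
  | succ n ih => push_cast; linarith [Rseq_add_one_le h n]

lemma exp_half_mul_Rseq_le {α : ℝ} (h : HasInfiniteExpansion α) {n : ℕ}
    (hn : logIter α n ≤ Rseq α n) (hR : Rseq α n ≤ Real.exp ((Rseq α n - 1) / 2)) :
    Real.exp (logIter α n / 2) * Rseq α n ≤ Rseq α (n + 1) := by
  rw [Rseq_succ_of_le h hn]
  have hl := logIter_pos h n
  set l := logIter α n
  set r := Rseq α n
  have hsplit : Real.exp l = Real.exp (l / 2) * Real.exp (l / 2) := by
    rw [← Real.exp_add]; ring_nf
  rw [hsplit, mul_assoc]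
  refine mul_le_mul_of_nonneg_left ?_ (Real.exp_pos _).le
  rcases le_or_gt l (r - 1) with hlr | hlr
  · have := Real.add_one_le_exp (l / 2)
    nlinarith
  · have h1 : Real.exp ((r - 1) / 2) ≤ Real.exp (l / 2) := Real.exp_le_exp.2 (by linarith)
    nlinarith [Real.exp_pos (l / 2)]

lemma HasQuadraticGrowth.exists_logSum_le_pow {α : ℝ} (h : HasInfiniteExpansion α)
    (hq : HasQuadraticGrowth α) :
    ∃ p N : ℕ, ∀ n ≥ N, 1 ≤ Rseq α n ∧ logSum α n ≤ Rseq α n ^ p := by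
  obtain ⟨A, hA, hq⟩ := hq
  have hlarge : ∀ᶠ r : ℝ in atTop, 4 * A * r ^ 2 ≤ Real.exp r ∧ r ≤ Real.exp ((r - 1) / 2) ∧
      2 ≤ r := by
    have hlin : Tendsto (fun r : ℝ => (r - 1) / 2) atTop atTop :=
      (tendsto_atTop_add_const_right _ _ tendsto_id).atTop_div_const two_pos
    filter_upwards [eventually_const_mul_pow_le_exp (4 * A) 2, eventually_ge_atTop 2,
      hlin.eventually (eventually_const_mul_pow_le_exp 3 1),
      hlin.eventually (eventually_ge_atTop 1)] with r h1 h2 h3 h4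
    exact ⟨h1, by linarith, h2⟩
  obtain ⟨r₀, hr₀⟩ := eventually_atTop.1 hlarge
  obtain ⟨N, hN⟩ := exists_nat_ge r₀
  have hlarge' : ∀ n ≥ N, r₀ ≤ Rseq α n := fun n hn =>
    hN.trans ((Nat.cast_le.2 hn).trans (natCast_le_Rseq h n))
  have htwo := (hr₀ _ (hlarge' N le_rfl)).2.2
  obtain ⟨p, hp⟩ := pow_unbounded_of_one_lt (logSum α N) (show 1 < Rseq α N by linarith)
  refine ⟨p + 1, N, fun n hn => ⟨by linarith [(hr₀ _ (hlarge' n hn)).2.2], ?_⟩⟩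
  induction n, hn using Nat.le_induction with
  | base => exact hp.le.trans (pow_le_pow_right₀ (by linarith) p.le_succ)
  | succ n hn ih =>
    obtain ⟨h1, h2, h3⟩ := hr₀ _ (hlarge' n hn)
    have hL := logSum_nonneg h n
    have hl := logIter_pos h n
    rcases le_or_gt (logIter α n) (Rseq α n) with hle | hlt
    · have h4 := exp_half_mul_Rseq_le h hle h2
      have h5 : Rseq α n + logIter α n ≤ Rseq α (n + 1) := by
        nlinarith [Real.add_one_le_exp (logIter α n / 2)]
      rw [logSum_succ]
      refine le_trans ?_ (pow_le_pow_left₀ (by linarith) h5 _)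
      have h6 : (1 : ℝ) ≤ (Rseq α n + logIter α n) ^ p := one_le_pow₀ (by linarith)
      have h7 : Rseq α n ^ p ≤ (Rseq α n + logIter α n) ^ p := by gcongr; linarith
      rw [pow_succ] at ih ⊢
      nlinarith
    · rw [Rseq_succ_of_lt hlt]
      have h4 : (1 : ℝ) ≤ Rseq α n ^ (p + 1) := one_le_pow₀ (by linarith)
      calc logSum α (n + 1) ≤ A * (1 + logSum α n) ^ 2 := hq n
        _ ≤ A * (Rseq α n ^ (p + 1) + Rseq α n ^ (p + 1)) ^ 2 := by gcongr
        _ = (4 * A) ^ 1 * (Rseq α n ^ 2) ^ (p + 1) := by ring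
        _ ≤ (4 * A) ^ (p + 1) * (Rseq α n ^ 2) ^ (p + 1) := by
          gcongr
          · linarith
          · omega
        _ = (4 * A * Rseq α n ^ 2) ^ (p + 1) := (mul_pow _ _ _).symm
        _ ≤ Real.exp (Rseq α n) ^ (p + 1) := by gcongr

lemma HasQuadraticGrowth.exists_le_Rseq {α : ℝ} (h : HasInfiniteExpansion α)
    (hq : HasQuadraticGrowth α) (C : ℝ) : ∃ k, C * (1 + logSum α k) ^ 2 ≤ Rseq α k := by
  wlog hC : 0 ≤ C generalizing C
  · obtain ⟨k, hk⟩ := this 0 le_rfl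
    exact ⟨k, le_trans (mul_le_mul_of_nonneg_right (not_le.1 hC).le (sq_nonneg _)) hk⟩
  obtain ⟨p, N, hpN⟩ := hq.exists_logSum_le_pow h
  obtain ⟨A, hA, hq⟩ := hq
  have hlin : Tendsto (fun r : ℝ => (r - 1) / 2) atTop atTop :=
    (tendsto_atTop_add_const_right _ _ tendsto_id).atTop_div_const two_pos
  obtain ⟨r₀, hr₀⟩ := eventually_atTop.1 ((eventually_const_mul_pow_le_exp
    (C * (1 + 4 * A) ^ 2) (4 * p)).and ((hlin.eventually (eventually_const_mul_pow_le_exp 3 1)).and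
    (hlin.eventually (eventually_ge_atTop 1))))
  obtain ⟨M, hM⟩ := exists_nat_ge r₀
  have hlarge : ∀ n ≥ max M N, r₀ ≤ Rseq α n := fun n hn =>
    hM.trans ((Nat.cast_le.2 ((le_max_left _ _).trans hn)).trans (natCast_le_Rseq h n))
  by_cases hex : ∃ n ≥ max M N, Rseq α n < logIter α n
  · obtain ⟨n, hn, hlt⟩ := hex
    refine ⟨n + 1, ?_⟩
    obtain ⟨h1, hL⟩ := hpN n ((le_max_right _ _).trans hn)
    have hL0 := logSum_nonneg h n
    have hL1 := logSum_nonneg h (n + 1)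
    rw [Rseq_succ_of_lt hlt]
    refine le_trans ?_ (hr₀ _ (hlarge n hn)).1
    have h2 : (1 : ℝ) ≤ Rseq α n ^ p := one_le_pow₀ h1
    have h3 : (1 : ℝ) ≤ Rseq α n ^ (2 * p) := one_le_pow₀ h1
    have h4 : logSum α (n + 1) ≤ 4 * A * Rseq α n ^ (2 * p) :=
      calc logSum α (n + 1) ≤ A * (1 + logSum α n) ^ 2 := hq n
        _ ≤ A * (Rseq α n ^ p + Rseq α n ^ p) ^ 2 := by gcongr
        _ = _ := by ring
    calc C * (1 + logSum α (n + 1)) ^ 2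
        ≤ C * (Rseq α n ^ (2 * p) + 4 * A * Rseq α n ^ (2 * p)) ^ 2 := by gcongr
      _ = _ := by ring
  · push Not at hex
    set m := max M N
    have hgrow : ∀ n ≥ m, Real.exp ((logSum α n - logSum α m) / 2) ≤ Rseq α n := by
      intro n hn
      induction n, hn using Nat.le_induction with
      | base => simpa using (hpN m (le_max_right _ _)).1
      | succ n hn ih =>
        obtain ⟨-, h2, h3⟩ := hr₀ _ (hlarge n hn)
        refine le_trans ?_ (exp_half_mul_Rseq_le h (hex n hn) (by linarith))
        rw [logSum_succ, show (logSum α n + logIter α n - logSum α m) / 2 =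
          logIter α n / 2 + (logSum α n - logSum α m) / 2 by ring, Real.exp_add]
        gcongr
    have hlim : Tendsto (fun n => (1 + logSum α n) / 2) atTop atTop :=
      (tendsto_atTop_add_const_left _ _ (tendsto_logSum h)).atTop_div_const two_pos
    obtain ⟨n, h1, hn⟩ := ((hlim.eventually (eventually_const_mul_pow_le_exp
      (4 * C * Real.exp ((1 + logSum α m) / 2)) 2)).and (eventually_ge_atTop m)).exists
    refine ⟨n, le_trans ?_ (hgrow n hn)⟩
    rw [show (logSum α n - logSum α m) / 2 = (1 + logSum α n) / 2 - (1 + logSum α m) / 2 by ring,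
      Real.exp_sub, le_div_iff₀ (Real.exp_pos _)]
    linarith

lemma HasQuadraticGrowth.satisfiesCondH {α : ℝ} (h : HasInfiniteExpansion α)
    (hq : HasQuadraticGrowth α) : SatisfiesCondH α := by
  refine ⟨hq.isBrjuno h, fun m => ?_⟩
  have hm := h.gaussIter m
  have hqm := hq.gaussIter h m
  obtain ⟨C, hC⟩ := hqm.exists_brjunoFunction_le hm
  obtain ⟨k, hk⟩ := hqm.exists_le_Rseq hm C
  refine ⟨k, ?_⟩
  rw [← gaussIter_gaussIter]
  exact (hC k).trans (ENNReal.ofReal_le_ofReal hk)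

/-! ### Diophantine numbers -/

lemma IsDiophantine.exists_logSum_succ_le {α : ℝ} (h : HasInfiniteExpansion α)
    (hd : IsDiophantine α) : ∃ A S : ℝ, 0 ≤ A ∧ 0 ≤ S ∧
      ∀ n, logSum α (n + 1) ≤ A + S * logSum α n := by
  obtain ⟨γ, hγ, σ, hσ, hd⟩ := hd
  refine ⟨|Real.log γ|, 1 + σ, abs_nonneg _, by linarith, fun n => ?_⟩
  obtain ⟨p, hp⟩ := exists_qden_mul_sub h n
  have hq : (0 : ℝ) < qden α n := by exact_mod_cast one_le_qden h n
  have h1 := hd p (qden α n) (one_le_qden h n)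
  have h2 : |α - p / qden α n| = Real.exp (-logSum α (n + 1)) / qden α n := by
    rw [show α - p / qden α n = (qden α n * α - p) / qden α n by field_simp, hp, abs_div, abs_mul,
      abs_pow, abs_neg, abs_one, one_pow, one_mul, Real.abs_exp, abs_of_pos hq]
  rw [h2, show (2 : ℝ) + σ = (1 + σ) + 1 by ring, Real.rpow_add_one hq.ne', ← div_div,
    div_le_div_iff_of_pos_right hq] at h1
  have h3 := Real.log_le_log (by positivity) h1
  rw [Real.log_exp, Real.log_div hγ.ne' (by positivity), Real.log_rpow hq] at h3
  have h4 : (1 + σ) * Real.log (qden α n) ≤ (1 + σ) * logSum α n :=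
    mul_le_mul_of_nonneg_left (log_qden_le h n) (by linarith)
  linarith [neg_le_abs (Real.log γ)]

lemma IsDiophantine.hasQuadraticGrowth {α : ℝ} (h : HasInfiniteExpansion α)
    (hd : IsDiophantine α) : HasQuadraticGrowth α := by
  obtain ⟨A, S, hA, hS, hd⟩ := hd.exists_logSum_succ_le h
  refine ⟨1 + A + S, by linarith, fun n => (hd n).trans ?_⟩
  have hL := logSum_nonneg h n
  nlinarith [mul_nonneg hA hL, mul_nonneg hS hL, mul_nonneg hA (sq_nonneg (logSum α n)),
    mul_nonneg hS (sq_nonneg (logSum α n))]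

/-! ### Numbers with prescribed partial quotients -/

lemma exists_truncated_expansion (n : ℕ) (a : ℕ → ℕ) (ha : ∀ k, 1 ≤ a k) :
    ∃ x : ℕ → ℝ, (∀ k, x k ∈ Set.Icc (0 : ℝ) 1) ∧ ∀ k < n, x k * (a k + x (k + 1)) = 1 := by
  induction n generalizing a with
  | zero => exact ⟨fun _ => 0, fun _ => by simp, fun k hk => absurd hk k.not_lt_zero⟩
  | succ n ih =>
    obtain ⟨x, hx, hxa⟩ := ih (fun k => a (k + 1)) fun k => ha (k + 1)
    have h1 : (1 : ℝ) ≤ a 0 + x 0 := by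
      have : (1 : ℝ) ≤ a 0 := by exact_mod_cast ha 0
      linarith [(hx 0).1]
    refine ⟨fun k => Nat.casesOn k (a 0 + x 0)⁻¹ x, fun k => ?_, fun k hk => ?_⟩
    · cases k with
      | zero => exact ⟨inv_nonneg.2 (by linarith), inv_le_one_of_one_le₀ h1⟩
      | succ k => exact hx k
    · cases k with
      | zero => exact inv_mul_cancel₀ (by linarith)
      | succ k => exact hxa k (by omega)

lemma exists_expansion (a : ℕ → ℕ) (ha : ∀ k, 1 ≤ a k) :
    ∃ x : ℕ → ℝ, (∀ k, x k ∈ Set.Icc (0 : ℝ) 1) ∧ ∀ k, x k * (a k + x (k + 1)) = 1 := by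
  let K : ℕ → Set (ℕ → ℝ) := fun n =>
    {x | (∀ k, x k ∈ Set.Icc (0 : ℝ) 1) ∧ ∀ k < n, x k * (a k + x (k + 1)) = 1}
  have hbox : IsCompact {x : ℕ → ℝ | ∀ k, x k ∈ Set.Icc (0 : ℝ) 1} :=
    isCompact_pi_infinite fun _ => isCompact_Icc
  have hclosed : ∀ n, IsClosed (K n) := fun n => by
    have hK : K n = {x : ℕ → ℝ | ∀ k, x k ∈ Set.Icc (0 : ℝ) 1} ∩
        ⋂ k, ⋂ _ : k < n, {x : ℕ → ℝ | x k * (a k + x (k + 1)) = 1} := by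
      ext x; simp [K]
    rw [hK]
    exact hbox.isClosed.inter (isClosed_iInter fun k => isClosed_iInter fun _ =>
      isClosed_eq (by fun_prop) continuous_const)
  obtain ⟨x, hx⟩ := IsCompact.nonempty_iInter_of_sequence_nonempty_isCompact_isClosed K
    (fun n x hx => ⟨hx.1, fun k hk => hx.2 k (by omega)⟩)
    (fun n => exists_truncated_expansion n a ha)
    (hbox.of_isClosed_subset (hclosed 0) fun x hx => hx.1) hclosed
  rw [Set.mem_iInter] at hx
  exact ⟨x, (hx 0).1, fun k => (hx (k + 1)).2 k k.lt_succ_self⟩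

lemma exists_hasInfiniteExpansion (a : ℕ → ℕ) (ha : ∀ k, 1 ≤ a k) :
    ∃ α ∈ Set.Ioo (0 : ℝ) 1, HasInfiniteExpansion α ∧
      ∀ n, (gaussIter α n)⁻¹ = a n + gaussIter α (n + 1) := by
  obtain ⟨x, hx, hxa⟩ := exists_expansion a ha
  have hpos : ∀ k, 0 < x k := fun k => lt_of_le_of_ne (hx k).1 fun h0 => by
    simpa [← h0] using hxa k
  have hlt : ∀ k, x k < 1 := fun k => by
    have h1 : (1 : ℝ) ≤ a k := by exact_mod_cast ha k
    nlinarith [hxa k, hpos k, hpos (k + 1), mul_pos (hpos k) (hpos (k + 1))]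
  have hinv : ∀ k, (x k)⁻¹ = a k + x (k + 1) := fun k => inv_eq_of_mul_eq_one_right (hxa k)
  have hfract : ∀ k, Int.fract (x k) = x k := fun k => Int.fract_eq_self.2 ⟨(hx k).1, hlt k⟩
  have hiter : ∀ k, gaussIter (x 0) k = x k := fun k => by
    induction k with
    | zero => exact hfract 0
    | succ k ih => rw [gaussIter, ih, hinv, Int.fract_natCast_add, hfract]
  refine ⟨x 0, ⟨hpos 0, hlt 0⟩, fun n => ?_, fun n => ?_⟩
  · rw [hiter]; exact ⟨hpos n, hlt n⟩
  · rw [hiter, hiter, hinv]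

lemma log_lt_logIter {α : ℝ} (h : HasInfiniteExpansion α) {a n : ℕ} (ha : 1 ≤ a)
    (hn : (gaussIter α n)⁻¹ = a + gaussIter α (n + 1)) : Real.log a < logIter α n := by
  have ha' : (0 : ℝ) < a := by exact_mod_cast ha
  rw [logIter, hn]
  exact Real.log_lt_log ha' (by linarith [(h (n + 1)).1])

lemma logIter_le_log_add_one {α : ℝ} (h : HasInfiniteExpansion α) {a n : ℕ}
    (hn : (gaussIter α n)⁻¹ = a + gaussIter α (n + 1)) : logIter α n ≤ Real.log (a + 1) := by
  have := inv_pos.2 (h n).1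
  rw [logIter]
  refine Real.log_le_log this ?_
  linarith [(h (n + 1)).2]

/-! ### A number satisfying condition `𝓗` that is not Diophantine -/

lemma exists_logIter_double_exponential : ∃ α ∈ Set.Ioo (0 : ℝ) 1, HasInfiniteExpansion α ∧
    ∀ n, 2 ^ 2 ^ n * Real.log 2 ≤ logIter α n ∧ logIter α n ≤ 2 * 2 ^ 2 ^ n * Real.log 2 := by
  have ha : ∀ n : ℕ, 1 ≤ 2 ^ 2 ^ 2 ^ n := fun n => Nat.one_le_two_pow
  obtain ⟨α, hα, h, hexp⟩ := exists_hasInfiniteExpansion (fun n => 2 ^ 2 ^ 2 ^ n) ha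
  have hl : 0 < Real.log 2 := Real.log_pos one_lt_two
  refine ⟨α, hα, h, fun n => ⟨?_, ?_⟩⟩
  · have := (log_lt_logIter h (ha n) (hexp n)).le
    push_cast at this
    rw [Real.log_pow] at this
    exact_mod_cast this
  · have h1 := logIter_le_log_add_one h (hexp n)
    have h2 : (1 : ℝ) ≤ 2 ^ 2 ^ 2 ^ n := one_le_pow₀ one_le_two
    have h3 : Real.log (2 ^ 2 ^ 2 ^ n + 1) ≤ Real.log (2 ^ (2 ^ 2 ^ n + 1)) := by
      refine Real.log_le_log (by positivity) ?_
      rw [pow_succ]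
      linarith
    rw [Real.log_pow] at h3
    push_cast at h1 h3
    have h4 : (1 : ℝ) ≤ 2 ^ 2 ^ n := one_le_pow₀ one_le_two
    nlinarith

lemma two_pow_two_pow_succ (n : ℕ) : (2 : ℝ) ^ 2 ^ (n + 1) = (2 ^ 2 ^ n) ^ 2 := by
  rw [← pow_mul, ← pow_succ]

lemma two_le_two_pow_two_pow (n : ℕ) : (2 : ℝ) ≤ 2 ^ 2 ^ n :=
  le_self_pow₀ one_le_two (by positivity)

lemma sum_two_pow_two_pow_le (n : ℕ) :
    ∑ j ∈ Finset.range (n + 1), (2 : ℝ) ^ 2 ^ j ≤ 2 * 2 ^ 2 ^ n := by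
  induction n with
  | zero => simp
  | succ n ih =>
    rw [Finset.sum_range_succ, two_pow_two_pow_succ]
    nlinarith [two_le_two_pow_two_pow n]

lemma logSum_succ_le_of_double_exponential {α : ℝ}
    (hup : ∀ n, logIter α n ≤ 2 * 2 ^ 2 ^ n * Real.log 2) (n : ℕ) :
    logSum α (n + 1) ≤ 4 * 2 ^ 2 ^ n := by
  have hl : 0 < Real.log 2 := Real.log_pos one_lt_two
  have hl1 : Real.log 2 ≤ 1 := by linarith [Real.log_two_lt_d9]
  have h1 : logSum α (n + 1) ≤ ∑ j ∈ Finset.range (n + 1), 2 * (2 : ℝ) ^ 2 ^ j :=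
    Finset.sum_le_sum fun j _ =>
      (hup j).trans (mul_le_of_le_one_right (by positivity) hl1)
  rw [← Finset.mul_sum] at h1
  linarith [sum_two_pow_two_pow_le n]

lemma exists_satisfiesCondH_not_isDiophantine :
    ∃ α ∈ Set.Ioo (0 : ℝ) 1, Irrational α ∧ SatisfiesCondH α ∧ ¬ IsDiophantine α := by
  obtain ⟨α, hα, h, hbd⟩ := exists_logIter_double_exponential
  have hup := logSum_succ_le_of_double_exponential fun n => (hbd n).2
  have hl : 1 / 2 < Real.log 2 := by linarith [Real.log_two_gt_d9]
  have hlow : ∀ n, 2 ^ 2 ^ n / 2 ≤ logSum α (n + 1) := fun n => by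
    have h1 : (0 : ℝ) < 2 ^ 2 ^ n := by positivity
    rw [logSum_succ]
    nlinarith [logSum_nonneg h n, (hbd n).1]
  refine ⟨α, hα, h.irrational, HasQuadraticGrowth.satisfiesCondH h ⟨16, by norm_num, fun n => ?_⟩,
    fun hd => ?_⟩
  · cases n with
    | zero =>
      have := hup 0
      norm_num [logSum_zero] at this ⊢
      linarith
    | succ n =>
      have h1 := hup (n + 1)
      rw [two_pow_two_pow_succ] at h1
      have h2 : (2 : ℝ) ^ 2 ^ n ≤ 2 * (1 + logSum α (n + 1)) := by linarith [hlow n]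
      have h3 : ((2 : ℝ) ^ 2 ^ n) ^ 2 ≤ (2 * (1 + logSum α (n + 1))) ^ 2 := by gcongr
      linarith
  · obtain ⟨A, S, hA, hS, hd⟩ := hd.exists_logSum_succ_le h
    obtain ⟨n, hn⟩ := pow_unbounded_of_one_lt (2 * A + 8 * S) (one_lt_two (α := ℝ))
    have hn' : (2 : ℝ) ^ n ≤ 2 ^ 2 ^ n := pow_le_pow_right₀ one_le_two Nat.lt_two_pow_self.le
    have h1 := (hlow (n + 1)).trans (hd (n + 1))
    rw [two_pow_two_pow_succ] at h1
    have h2 : S * logSum α (n + 1) ≤ S * (4 * 2 ^ 2 ^ n) := mul_le_mul_of_nonneg_left (hup n) hS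
    nlinarith [two_le_two_pow_two_pow n]

/-! ### A Brjuno number that does not satisfy condition `𝓗` -/

/-- The exponential tower `0, 1, e, e ^ e, …`. -/
noncomputable def expTower : ℕ → ℝ
  | 0 => 0
  | n + 1 => Real.exp (expTower n)

lemma expTower_nonneg (n : ℕ) : 0 ≤ expTower n := by
  cases n with
  | zero => exact le_rfl
  | succ n => exact (Real.exp_pos _).le

lemma exists_logIter_expTower : ∃ α ∈ Set.Ioo (0 : ℝ) 1, HasInfiniteExpansion α ∧
    ∀ n, expTower n < logIter α n ∧ logIter α n ≤ expTower n + 2 := by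
  have ha : ∀ n : ℕ, 1 ≤ ⌈Real.exp (expTower n)⌉₊ := fun n => Nat.ceil_pos.2 (Real.exp_pos _)
  obtain ⟨α, hα, h, hexp⟩ := exists_hasInfiniteExpansion (fun n => ⌈Real.exp (expTower n)⌉₊) ha
  refine ⟨α, hα, h, fun n => ⟨?_, ?_⟩⟩
  · refine lt_of_le_of_lt ?_ (log_lt_logIter h (ha n) (hexp n))
    rw [Real.le_log_iff_exp_le (by exact_mod_cast ha n)]
    exact Nat.le_ceil _
  · refine (logIter_le_log_add_one h (hexp n)).trans ?_
    rw [Real.log_le_iff_le_exp (by positivity), Real.exp_add]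
    have h1 := Nat.ceil_lt_add_one (Real.exp_pos (expTower n)).le
    have h2 := Real.one_le_exp (expTower_nonneg n)
    have h3 := Real.add_one_le_exp 2
    nlinarith

lemma exists_isBrjuno_not_satisfiesCondH :
    ∃ α ∈ Set.Ioo (0 : ℝ) 1, Irrational α ∧ IsBrjuno α ∧ ¬ SatisfiesCondH α := by
  obtain ⟨α, hα, h, hbd⟩ := exists_logIter_expTower
  refine ⟨α, hα, h.irrational, isBrjuno_of_summable h ?_, fun hH => ?_⟩
  · have hexp_le : ∀ n, Real.exp (-logSum α n) ≤ Real.exp (-(logSum α n / 2)) := fun n =>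
      Real.exp_le_exp.2 (by linarith [logSum_nonneg h n])
    rw [← summable_nat_add_iff 1]
    have hsum := summable_exp_neg_half_logSum h
    refine (hsum.add (((summable_nat_add_iff 1).2 hsum).mul_left 2)).of_nonneg_of_le
      (fun n => mul_nonneg (Real.exp_pos _).le (logIter_pos h _).le) fun n => ?_
    have h1 : Real.exp (-logSum α (n + 1)) * expTower (n + 1) ≤ Real.exp (-logSum α n) := by
      rw [expTower, ← Real.exp_add, Real.exp_le_exp, logSum_succ]
      linarith [(hbd n).1]
    have h2 := mul_le_mul_of_nonneg_left (hbd (n + 1)).2 (Real.exp_pos (-logSum α (n + 1))).le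
    linarith [hexp_le n, hexp_le (n + 1)]
  · have hR : ∀ n, Rseq α n = expTower n := fun n => by
      induction n with
      | zero => rfl
      | succ n ih => rw [Rseq_succ_of_lt (ih ▸ (hbd n).1), ih, expTower]
    obtain ⟨k, hk⟩ := hH.2 0
    have h0 : gaussIter α 0 = α := Int.fract_eq_self.2 ⟨hα.1.le, hα.2⟩
    rw [zero_add, h0, hR] at hk
    have h1 : ENNReal.ofReal (logIter α k) ≤ brjunoFunction (gaussIter α k) := by
      refine le_trans (le_of_eq ?_) (ENNReal.le_tsum 0)
      rw [Finset.prod_range_zero, one_mul, gaussIter_gaussIter]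
      rfl
    exact absurd ((ENNReal.ofReal_le_ofReal_iff (expTower_nonneg k)).1 (h1.trans hk))
      (not_le.2 (hbd k).1)

/-- **Yoccoz.** `CD ⊂ 𝓗 ⊂ 𝓑` and both inclusions are strict. -/
theorem yoccoz_strict_inclusions : CDSet ⊂ HSet ∧ HSet ⊂ BSet := by
  constructor
  · obtain ⟨α, hα, hirr, hH, hd⟩ := exists_satisfiesCondH_not_isDiophantine
    refine (Set.ssubset_iff_of_subset fun β hβ => ?_).2
      ⟨α, ⟨hα, hirr, hH⟩, fun hC => hd hC.2.2⟩
    have h := hβ.2.1.hasInfiniteExpansion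
    exact ⟨hβ.1, hβ.2.1, (hβ.2.2.hasQuadraticGrowth h).satisfiesCondH h⟩
  · obtain ⟨α, hα, hirr, hB, hH⟩ := exists_isBrjuno_not_satisfiesCondH
    have hsub : HSet ⊆ BSet := fun β hβ => ⟨hβ.1, hβ.2.1, hβ.2.2.1⟩
    exact (Set.ssubset_iff_of_subset hsub).2 ⟨α, ⟨hα, hirr, hB⟩, fun hC => hH hC.2.2⟩
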